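/- Let p be a prime and let K be a finite extension of ℚ_p containing a primitive p-th root of unity. A unit α ∈ O_K^× is p-primary if and only if α can be written as α = u · w^p with u ∈ U_{pē_K, K} and w ∈ O_K^×, where ē_K = e_K/(p−1) and e_K is the absolute ramification index of K; equivalently, the image of α in K^×/(K^×)^p lies in the subgroup generated by the image of U_{pē_K, K}. -/

import Mathlib

set_option synthInstance.maxHeartbeats 1000000
set_option maxHeartbeats 1000000
noncomputable section

namespace PadicStmt

variable (p : ℕ) [Fact p.Prime]

/-- The `ℤ_[p]`-algebra structure on a `ℚ_[p]`-algebra. -/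
noncomputable instance zpAlgebra (K : Type) [Field K] [Algebra ℚ_[p] K] :
    Algebra ℤ_[p] K :=
  ((algebraMap ℚ_[p] K).comp (algebraMap ℤ_[p] ℚ_[p])).toAlgebra

instance zpTower (K : Type) [Field K] [Algebra ℚ_[p] K] :
    IsScalarTower ℤ_[p] ℚ_[p] K :=
  IsScalarTower.of_algebraMap_eq fun _ => rfl

instance zpTower' (K L : Type) [Field K] [Field L] [Algebra ℚ_[p] K] [Algebra ℚ_[p] L]
    [Algebra K L] [IsScalarTower ℚ_[p] K L] : IsScalarTower ℤ_[p] K L :=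
  IsScalarTower.of_algebraMap_eq fun x => by
    rw [IsScalarTower.algebraMap_apply ℤ_[p] ℚ_[p] L, IsScalarTower.algebraMap_apply ℚ_[p] K L,
      IsScalarTower.algebraMap_apply ℤ_[p] ℚ_[p] K]

/-- The ring of integers of a `p`-adic field `K`, i.e. the integral closure of `ℤ_[p]` in `K`. -/
abbrev O (K : Type) [Field K] [Algebra ℚ_[p] K] := integralClosure ℤ_[p] K

/-- The natural map `O_K → O_L` for an extension `L/K` of `p`-adic fields. -/
def intMap (K L : Type) [Field K] [Field L] [Algebra ℚ_[p] K] [Algebra ℚ_[p] L]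
    [Algebra K L] [IsScalarTower ℚ_[p] K L] : O p K →+* O p L where
  toFun x := ⟨algebraMap K L x.1, IsIntegral.map (IsScalarTower.toAlgHom ℤ_[p] K L) x.2⟩
  map_one' := Subtype.ext (map_one _)
  map_mul' x y := Subtype.ext (map_mul _ _ _)
  map_zero' := Subtype.ext (map_zero _)
  map_add' x y := Subtype.ext (map_add _ _ _)

/-- The maximal ideal of the ring of integers of a `p`-adic field, described as the
Jacobson radical of `⊥`. -/
def maxIdeal (K : Type) [Field K] [Algebra ℚ_[p] K] : Ideal (O p K) :=
  (⊥ : Ideal (O p K)).jacobson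

/-- `v_K x ≥ n`:  `x` is integral and lies in the `n`-th power of the maximal ideal. -/
def ValGE (K : Type) [Field K] [Algebra ℚ_[p] K] (n : ℕ) (x : K) : Prop :=
  ∃ y : O p K, (y : K) = x ∧ y ∈ (maxIdeal p K) ^ n

/-- `x : K` is a unit of the ring of integers `O_K`. -/
def IsIntegralUnit (K : Type) [Field K] [Algebra ℚ_[p] K] (x : K) : Prop :=
  ∃ u : (O p K)ˣ, ((u : O p K) : K) = x

/-- `x ∈ U_{n,K}`, the `n`-th unit group: `x` is a unit of `O_K` and `v_K (1 - x) ≥ n`. -/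
def InU (K : Type) [Field K] [Algebra ℚ_[p] K] (n : ℕ) (x : K) : Prop :=
  IsIntegralUnit p K x ∧ ValGE p K n (1 - x)

/-- An extension `L/K` of `p`-adic fields is unramified iff `m_K O_L = m_L`
(i.e. the ramification index is `1`; the residue extension is automatically separable). -/
def IsUnramifiedExt (K L : Type) [Field K] [Field L] [Algebra ℚ_[p] K] [Algebra ℚ_[p] L]
    [Algebra K L] [IsScalarTower ℚ_[p] K L] : Prop :=
  Ideal.map (intMap p K L) (maxIdeal p K) = maxIdeal p L

/-- An extension `L/K` of `p`-adic fields is totally ramified iff its residue degree is `1`,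
i.e. `O_L = O_K + m_L`. -/
def IsTotallyRamifiedExt (K L : Type) [Field K] [Field L] [Algebra ℚ_[p] K] [Algebra ℚ_[p] L]
    [Algebra K L] [IsScalarTower ℚ_[p] K L] : Prop :=
  ∀ x : O p L, ∃ y : O p K, x - intMap p K L y ∈ maxIdeal p L

/-- A witness that `α : K` acquires an `n`-th root in some unramified extension of `K`. -/
structure UnramifiedRootWitness (K : Type) [Field K] [Algebra ℚ_[p] K] (n : ℕ) (α : K) where
  L : Type
  [fieldL : Field L]
  [algQL : Algebra ℚ_[p] L]
  [algKL : Algebra K L]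
  [tower : IsScalarTower ℚ_[p] K L]
  [fin : FiniteDimensional ℚ_[p] L]
  β : L
  pow_eq : β ^ n = algebraMap K L α
  unram : IsUnramifiedExt p K L

/-- A unit `α` of `O_K` is `p`-primary if `K(α^{1/p})/K` is unramified, equivalently `α`
admits a `p`-th root in an unramified extension of `K`. -/
def IsPPrimary (K : Type) [Field K] [Algebra ℚ_[p] K] (α : K) : Prop :=
  IsIntegralUnit p K α ∧ Nonempty (UnramifiedRootWitness p K p α)

end PadicStmt

open PadicStmt

/-- The absolute ramification index `e_K = v_K(p)` of a `p`-adic field `K`. -/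
noncomputable def eK (p : ℕ) [Fact p.Prime] (K : Type) [Field K] [Algebra ℚ_[p] K] : ℕ :=
  sSup {n : ℕ | ValGE p K n ((p : ℕ) : K)}

namespace PadicStmt

section RingOfIntegers

variable (p : ℕ) [Fact p.Prime] (K : Type) [Field K] [Algebra ℚ_[p] K]

theorem isIntegral_iff_spectralNorm_le_one [Algebra.IsAlgebraic ℚ_[p] K] (x : K) :
    IsIntegral ℤ_[p] x ↔ spectralNorm ℚ_[p] K x ≤ 1 := by
  have hx : IsIntegral ℚ_[p] x := Algebra.IsIntegral.isIntegral x
  rw [spectralNorm, spectralValue_le_one_iff (minpoly.monic hx)]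
  constructor
  · intro h n
    rw [minpoly.isIntegrallyClosed_eq_field_fractions' ℚ_[p] h, Polynomial.coeff_map]
    exact PadicInt.norm_le_one _
  · intro h
    have hl : minpoly ℚ_[p] x ∈ Polynomial.lifts (algebraMap ℤ_[p] ℚ_[p]) := by
      rw [Polynomial.lifts_iff_coeff_lifts]
      exact fun n => ⟨⟨_, h n⟩, rfl⟩
    obtain ⟨q, hq, -, hqm⟩ := Polynomial.lifts_and_degree_eq_and_monic hl (minpoly.monic hx)
    refine ⟨q, hqm, ?_⟩
    rw [IsScalarTower.algebraMap_eq ℤ_[p] ℚ_[p] K, ← Polynomial.eval₂_map, hq]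
    exact minpoly.aeval _ _

instance isLocalRing_O [Algebra.IsAlgebraic ℚ_[p] K] : IsLocalRing (O p K) := by
  have unit_of : ∀ a : O p K, spectralNorm ℚ_[p] K (a : K) = 1 → IsUnit a := by
    intro a ha
    have ha0 : (a : K) ≠ 0 := by
      intro h
      rw [h, spectralNorm_zero] at ha
      exact zero_ne_one ha
    have hmul := spectralAlgNorm_mul (K := ℚ_[p]) (a : K) (a : K)⁻¹
    rw [mul_inv_cancel₀ ha0, spectralAlgNorm_one, spectralAlgNorm_def, ha, one_mul] at hmul
    have hint : IsIntegral ℤ_[p] (a : K)⁻¹ :=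
      (isIntegral_iff_spectralNorm_le_one p K _).2 hmul.symm.le
    exact IsUnit.of_mul_eq_one ⟨_, hint⟩ (Subtype.ext (mul_inv_cancel₀ ha0))
  refine IsLocalRing.of_isUnit_or_isUnit_one_sub_self fun a => ?_
  have h1 := (isIntegral_iff_spectralNorm_le_one p K _).1 a.2
  have h2 := (isIntegral_iff_spectralNorm_le_one p K _).1 (1 - a).2
  by_contra! hcon
  have h1' := lt_of_le_of_ne h1 fun h => hcon.1 (unit_of _ h)
  have h2' := lt_of_le_of_ne h2 fun h => hcon.2 (unit_of _ h)
  have h3 := isNonarchimedean_spectralNorm (K := ℚ_[p]) (L := K) (a : K) ((1 - a : O p K) : K)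
  have h4 : (a : K) + ((1 - a : O p K) : K) = 1 := by push_cast; ring
  rw [h4, spectralNorm_one] at h3
  exact absurd h3 (not_le.2 (max_lt h1' h2'))

variable [FiniteDimensional ℚ_[p] K]

instance isDedekindDomain_O : IsDedekindDomain (O p K) :=
  integralClosure.isDedekindDomain ℤ_[p] ℚ_[p] K

instance finite_O : Module.Finite ℤ_[p] (O p K) :=
  IsIntegralClosure.finite ℤ_[p] ℚ_[p] K (O p K)

instance isFractionRing_O : IsFractionRing (O p K) K :=
  integralClosure.isFractionRing_of_finite_extension ℚ_[p] K

instance charZero_O : CharZero (O p K) := by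
  have : CharZero K := charZero_of_injective_algebraMap (algebraMap ℚ_[p] K).injective
  refine ⟨fun m n h => ?_⟩
  have := congrArg (fun x : O p K => (x : K)) h
  simpa using this

instance faithfulSMul_O : FaithfulSMul ℤ_[p] (O p K) := by
  rw [faithfulSMul_iff_algebraMap_injective]
  intro x y h
  have h' : algebraMap ℚ_[p] K x = algebraMap ℚ_[p] K y := congrArg (fun x : O p K => (x : K)) h
  exact Subtype.ext ((algebraMap ℚ_[p] K).injective h')

theorem natCast_mem_maximalIdeal : (p : O p K) ∈ IsLocalRing.maximalIdeal (O p K) := by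
  rw [IsLocalRing.mem_maximalIdeal, mem_nonunits_iff]
  intro h
  have h' : IsUnit (algebraMap ℤ_[p] (O p K) p) := by simpa using h
  exact PadicInt.p_nonunit (isUnit_of_map_unit _ _ h')

instance isDiscreteValuationRing_O : IsDiscreteValuationRing (O p K) := by
  refine ((IsDiscreteValuationRing.TFAE (O p K) ?_).out 0 2 rfl rfl).mpr inferInstance
  intro h
  rw [IsLocalRing.isField_iff_maximalIdeal_eq] at h
  have := natCast_mem_maximalIdeal p K
  rw [h, Ideal.mem_bot] at this
  exact (Fact.out : p.Prime).ne_zero (by exact_mod_cast this)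

theorem maxIdeal_eq_maximalIdeal : maxIdeal p K = IsLocalRing.maximalIdeal (O p K) :=
  IsLocalRing.jacobson_eq_maximalIdeal ⊥ bot_ne_top

instance finite_residueField_O : Finite (IsLocalRing.ResidueField (O p K)) := by
  have : Finite (IsLocalRing.ResidueField ℤ_[p]) := inferInstance
  have : Module.Finite (IsLocalRing.ResidueField ℤ_[p]) (IsLocalRing.ResidueField (O p K)) :=
    inferInstance
  exact Module.finite_of_finite (IsLocalRing.ResidueField ℤ_[p])

theorem exists_sub_pow_mem_maximalIdeal (a : O p K) :
    ∃ b : O p K, a - b ^ p ∈ IsLocalRing.maximalIdeal (O p K) := by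
  have h0 : ((p : ℕ) : IsLocalRing.ResidueField (O p K)) = 0 := by
    have := (IsLocalRing.residue_eq_zero_iff _).2 (natCast_mem_maximalIdeal p K)
    simpa using this
  have : CharP (IsLocalRing.ResidueField (O p K)) p :=
    (CharP.charP_iff_prime_eq_zero Fact.out).2 h0
  obtain ⟨b, hb⟩ := surjective_frobenius (IsLocalRing.ResidueField (O p K)) p
    (IsLocalRing.residue _ a)
  obtain ⟨b, rfl⟩ := IsLocalRing.residue_surjective b
  refine ⟨b, (IsLocalRing.residue_eq_zero_iff _).1 ?_⟩
  rw [map_sub, map_pow, ← hb, frobenius_def, sub_self]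

variable {p K}

theorem associated_natCast_pow_eK {π : O p K} (hπ : Irreducible π) :
    Associated (p : O p K) (π ^ eK p K) := by
  have hp0 : (p : O p K) ≠ 0 := Nat.cast_ne_zero.2 (Fact.out : p.Prime).ne_zero
  obtain ⟨e, he⟩ := IsDiscreteValuationRing.associated_pow_irreducible hp0 hπ
  have hset : {n : ℕ | ValGE p K n ((p : ℕ) : K)} = Set.Iic e := by
    ext n
    have : ValGE p K n ((p : ℕ) : K) ↔ (p : O p K) ∈ maxIdeal p K ^ n := by
      constructor
      · rintro ⟨y, hy, hyn⟩
        have : y = p := Subtype.ext (by simpa using hy)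
        rwa [← this]
      · intro h
        exact ⟨p, by simp, h⟩
    rw [Set.mem_ofPred_eq, this, maxIdeal_eq_maximalIdeal, hπ.maximalIdeal_eq,
      Ideal.span_singleton_pow, Ideal.mem_span_singleton, he.dvd_iff_dvd_right,
      pow_dvd_pow_iff hπ.ne_zero hπ.not_isUnit, Set.mem_Iic]
  rw [eK, hset, csSup_Iic]
  exact he

theorem inU_coe_iff {π : O p K} (hπ : Irreducible π) {n : ℕ} (u : (O p K)ˣ) :
    InU p K n ((u : O p K) : K) ↔ π ^ n ∣ (u : O p K) - 1 := by
  rw [← dvd_neg, neg_sub, ← Ideal.mem_span_singleton, ← Ideal.span_singleton_pow,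
    ← hπ.maximalIdeal_eq, ← maxIdeal_eq_maximalIdeal]
  constructor
  · rintro ⟨-, y, hy, hyn⟩
    have : y = 1 - (u : O p K) := Subtype.ext (by simpa using hy)
    rwa [← this]
  · intro h
    exact ⟨⟨u, rfl⟩, _, by simp, h⟩

end RingOfIntegers

section PowCongruence

theorem pow_succ_dvd_or_eq_mul_of_pow_dvd_one_add_pow_sub_one {S : Type*} [CommRing S] [IsDomain S]
    [IsDiscreteValuationRing S] {p m n : ℕ} (hp : p.Prime) {π b : S} (hπ : Irreducible π)
    (hpπ : π ^ (m * (p - 1)) ∣ (p : S)) (hn : n < p * m) (hb : π ^ n ∣ (1 + b) ^ p - 1) :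
    π ^ (n + 1) ∣ (1 + b) ^ p - 1 ∨ ∃ i < m, n = p * i := by
  rcases eq_or_ne b 0 with rfl | hb0
  · simp
  obtain ⟨i, u, rfl⟩ := IsDiscreteValuationRing.eq_unit_mul_pow_irreducible hb0 hπ
  obtain ⟨r, hr⟩ := exists_add_pow_prime_eq hp (1 : S) (u * π ^ i)
  have hexp : (1 + u * π ^ i) ^ p - 1 = u ^ p * π ^ (p * i) + p * (u * π ^ i) * r := by
    rw [hr, mul_pow, ← pow_mul, mul_comm i]; ring
  rw [hexp] at hb ⊢
  have hsecond : π ^ (m * (p - 1) + i) ∣ p * (u * π ^ i) * r := by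
    rw [pow_add]
    exact (mul_dvd_mul hpπ (dvd_mul_left _ _)).mul_right _
  obtain ⟨q, rfl⟩ : ∃ q, p = q + 1 := ⟨p - 1, by have := hp.pos; omega⟩
  rw [Nat.add_sub_cancel] at hsecond
  rcases le_or_gt m i with hi | hi
  · left
    have h1 : n + 1 ≤ (q + 1) * i := by nlinarith
    have h2 : n + 1 ≤ m * q + i := by nlinarith
    exact dvd_add ((pow_dvd_pow π h1).mul_left _) ((pow_dvd_pow π h2).trans hsecond)
  · have h2 : (q + 1) * i + 1 ≤ m * q + i := by
      have := hp.two_le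
      have : i * q + 1 ≤ m * q := by nlinarith
      nlinarith
    rcases lt_trichotomy n ((q + 1) * i) with h | h | h
    · left
      exact dvd_add ((pow_dvd_pow π h).mul_left _)
        ((pow_dvd_pow π (by omega)).trans hsecond)
    · exact Or.inr ⟨i, hi, h⟩
    · exfalso
      have h3 := (pow_dvd_pow π h).trans hb
      rw [Nat.succ_eq_add_one, dvd_add_left ((pow_dvd_pow π h2).trans hsecond),
        (u.isUnit.pow _).dvd_mul_left, pow_dvd_pow_iff hπ.ne_zero hπ.not_isUnit] at h3
      omega

theorem exists_isUnit_pow_succ_dvd_mul_pow_sub_one {A : Type*} [CommRing A] [IsLocalRing A]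
    {p m i : ℕ} (hp : p.Prime) {π a : A} (hπ : π ∈ IsLocalRing.maximalIdeal A)
    (hpow : ∀ a : A, ∃ b, π ∣ a - b ^ p)
    (hpπ : π ^ (m * (p - 1)) ∣ (p : A)) (hi : i < m) (ha : IsUnit a)
    (hdvd : π ^ (p * i) ∣ a - 1) :
    ∃ w : A, IsUnit w ∧ π ^ (p * i + 1) ∣ a * w ^ p - 1 := by
  rcases Nat.eq_zero_or_pos i with rfl | hi0
  · obtain ⟨a, rfl⟩ := ha
    obtain ⟨w, hw⟩ := hpow (↑a⁻¹ : A)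
    refine ⟨w, ?_, ?_⟩
    · have hmem : (↑a⁻¹ : A) - w ^ p ∈ IsLocalRing.maximalIdeal A :=
        Ideal.mem_of_dvd _ hw hπ
      by_contra hcon
      have hw' : w ^ p ∈ IsLocalRing.maximalIdeal A :=
        Ideal.pow_mem_of_mem _ ((IsLocalRing.mem_maximalIdeal _).2 hcon) _ hp.pos
      exact (IsLocalRing.mem_maximalIdeal _).1 (by simpa using add_mem hmem hw') a⁻¹.isUnit
    · have : (a : A) * w ^ p - 1 = -(a * (↑a⁻¹ - w ^ p)) := by
        rw [mul_sub, Units.mul_inv]; ring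
      rw [this, mul_zero, zero_add, pow_one]
      exact (hw.mul_left _).neg_right
  · obtain ⟨c, hc⟩ := hdvd
    obtain ⟨b, hb⟩ := hpow (-c)
    obtain ⟨r, hr⟩ := exists_add_pow_prime_eq hp (1 : A) (π ^ i * b)
    have hsmall : π ^ (p * i + 1) ∣ p * (π ^ i * b) := by
      have h2 : p * i + 1 ≤ m * (p - 1) + i := by
        obtain ⟨q, rfl⟩ : ∃ q, p = q + 1 := ⟨p - 1, by have := hp.pos; omega⟩
        rw [Nat.add_sub_cancel]
        have := hp.two_le
        have : i * q + 1 ≤ m * q := by nlinarith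
        nlinarith
      refine (pow_dvd_pow π h2).trans ?_
      rw [pow_add]
      exact mul_dvd_mul hpπ (dvd_mul_right _ _)
    refine ⟨1 + π ^ i * b, ?_, ?_⟩
    · by_contra hcon
      have hmem : π ^ i * b ∈ IsLocalRing.maximalIdeal A :=
        Ideal.mul_mem_right _ _ (Ideal.pow_mem_of_mem _ hπ _ hi0)
      have := sub_mem ((IsLocalRing.mem_maximalIdeal _).2 hcon) hmem
      rw [add_sub_cancel_right] at this
      exact (IsLocalRing.mem_maximalIdeal _).1 this isUnit_one
    · obtain ⟨t, ht⟩ := hb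
      obtain ⟨s, hs⟩ := hsmall
      have ha' : a = 1 + π ^ (p * i) * c := by rw [← hc]; ring
      have hbp : b ^ p = -c - π * t := by rw [← ht]; ring
      obtain ⟨l, hl⟩ : ∃ l, p * i = l + 1 :=
        ⟨p * i - 1, by have := Nat.mul_pos hp.pos hi0; omega⟩
      have h1 : 1 + (1 : A) * (1 * (1 + π ^ i * b) ^ p - 1) = (1 + π ^ i * b) ^ p := by ring
      have hw : (1 + π ^ i * b) ^ p = 1 + π ^ (p * i) * (-c - π * t) + π ^ (p * i + 1) * s * r := by
        rw [hr, mul_pow, ← pow_mul, mul_comm i p, hbp, mul_one, hs, one_pow]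
      rw [hw, ha', hl]
      exact ⟨(1 + π ^ (l + 1) * c) * (-t + s * r) - π ^ l * c * c, by ring⟩

end PowCongruence

section MonogenicUnramified

open Polynomial

theorem formallyUnramified_of_adjoin_eq_top {A B : Type*} [CommRing A] [CommRing B] [Algebra A B]
    {f : A[X]} {z : B} (hz : Algebra.adjoin A {z} = ⊤) (hf : aeval z f = 0)
    (hf' : IsUnit (aeval z (derivative f))) : Algebra.FormallyUnramified A B := by
  rw [Algebra.formallyUnramified_iff]
  have hDz : KaehlerDifferential.D A B z = 0 := by
    have h := Derivation.map_aeval (KaehlerDifferential.D A B) f z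
    rw [hf, map_zero] at h
    exact (hf'.smul_eq_zero).1 h.symm
  have hD : KaehlerDifferential.D A B = 0 := by
    refine Derivation.ext_of_adjoin_eq_top {z} hz ?_
    rintro _ rfl
    simpa using hDz
  have hspan := KaehlerDifferential.span_range_derivation A B
  rw [hD] at hspan
  refine (Submodule.subsingleton_iff B).1 (subsingleton_of_bot_eq_top ?_)
  rw [← hspan, eq_comm, Submodule.span_eq_bot]
  rintro _ ⟨x, rfl⟩
  rfl

theorem adjoin_eq_top_of_isUnit_aeval_derivative (A K L : Type*) {B : Type*} [CommRing A]
    [IsDedekindDomain A] [Field K] [Algebra A K] [IsFractionRing A K] [CommRing B]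
    [IsDedekindDomain B] [Field L] [Algebra B L] [Algebra A B] [Algebra K L]
    [Algebra A L] [IsScalarTower A K L] [IsScalarTower A B L] [IsIntegralClosure B A L]
    [FiniteDimensional K L] [Algebra.IsSeparable K L]
    {f : A[X]} {z : B} (hz : Algebra.adjoin K {algebraMap B L z} = ⊤) (hf : aeval z f = 0)
    (hf' : IsUnit (aeval z (derivative f))) : Algebra.adjoin A {z} = ⊤ := by
  have := IsIntegralClosure.isFractionRing_of_finite_extension A K L B
  have hinj : Function.Injective (algebraMap A B) := by
    have h : Function.Injective (algebraMap A L) := by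
      rw [IsScalarTower.algebraMap_eq A K L]
      exact (algebraMap K L).injective.comp (IsFractionRing.injective A K)
    rw [IsScalarTower.algebraMap_eq A B L] at h
    exact Function.Injective.of_comp h
  have : FaithfulSMul A B := (faithfulSMul_iff_algebraMap_injective A B).2 hinj
  have : Module.IsTorsionFree A B := inferInstance
  have hAz : IsIntegral A z := IsIntegralClosure.isIntegral A L z
  obtain ⟨h, rfl⟩ := minpoly.isIntegrallyClosed_dvd hAz hf
  have hmin : IsUnit (aeval z (derivative (minpoly A z))) := by
    rw [derivative_mul, map_add, map_mul, map_mul, minpoly.aeval, zero_mul, add_zero] at hf'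
    exact isUnit_of_mul_isUnit_left hf'
  have hc := conductor_mul_differentIdeal A K L z hz
  rw [Ideal.span_singleton_eq_top.2 hmin] at hc
  exact conductor_eq_top_iff_adjoin_eq_top.1 (top_le_iff.1 (hc ▸ Ideal.mul_le_left))

theorem exists_one_add_C_mul_X_pow_eq {A : Type*} [CommRing A] {p : ℕ} (hp : p.Prime)
    {π s v l : A} (hl : l = π * s) (hv : (p : A) = v * l ^ (p - 1)) :
    ∃ g : A[X], g.degree < p ∧
      (1 + C l * X) ^ p = 1 + C (l ^ p) * (X ^ p + C v * (X + C π * g)) := by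
  refine ⟨∑ k ∈ Finset.Ico 2 p, C (((p.choose k / p : ℕ) : A) * (s * l ^ (k - 2))) * X ^ k, ?_, ?_⟩
  · rw [← mem_degreeLT]
    refine sum_mem fun k hk => mem_degreeLT.2 ?_
    exact (degree_C_mul_X_pow_le _ _).trans_lt (by exact_mod_cast (Finset.mem_Ico.1 hk).2)
  · have hpl : (p : A[X]) * C l = C (l ^ p) * C v := by
      rw [← map_natCast (C : A →+* A[X]), hv, ← C_mul, ← C_mul]
      congr 1
      rw [mul_assoc, ← pow_succ, Nat.sub_add_cancel hp.one_le, mul_comm]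
    rw [add_comm (1 : A[X]), add_pow, Finset.sum_range_succ, Finset.range_eq_Ico,
      Finset.sum_eq_sum_Ico_succ_bot hp.pos, Finset.sum_eq_sum_Ico_succ_bot hp.one_lt]
    have hterm : ∑ k ∈ Finset.Ico (0 + 1 + 1) p,
          (C l * X) ^ k * 1 ^ (p - k) * (p.choose k : A[X])
        = C (l ^ p) * (C v * (C π * ∑ k ∈ Finset.Ico 2 p,
          C (((p.choose k / p : ℕ) : A) * (s * l ^ (k - 2))) * X ^ k)) := by
      simp_rw [Finset.mul_sum]
      refine Finset.sum_congr rfl fun k hk => ?_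
      obtain ⟨hk2, hkp⟩ := Finset.mem_Ico.1 hk
      obtain ⟨j, rfl⟩ : ∃ j, k = j + 2 := ⟨k - 2, by omega⟩
      obtain ⟨c, hc⟩ := hp.dvd_choose_self (by omega : j + 2 ≠ 0) hkp
      rw [hc, Nat.mul_div_cancel_left _ hp.pos, Nat.add_sub_cancel]
      have : C l = C π * C s := by rw [hl, C_mul]
      simp only [one_pow, mul_one, mul_pow, Nat.cast_mul, C_mul, map_natCast]
      calc C l ^ (j + 2) * X ^ (j + 2) * ((p : A[X]) * (c : A[X]))
          = ((p : A[X]) * C l) * C l * C l ^ j * X ^ (j + 2) * (c : A[X]) := by ring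
        _ = (C (l ^ p) * C v) * (C π * C s) * C l ^ j * X ^ (j + 2) * (c : A[X]) := by rw [hpl, this]
        _ = _ := by simp only [C_pow]; ring
    rw [hterm]
    simp only [Nat.choose_self, Nat.choose_one_right, Nat.choose_zero_right, Nat.cast_one, mul_one,
      one_pow, pow_zero, pow_one, mul_pow, ← C_pow]
    linear_combination X * hpl

end MonogenicUnramified

section Extension

variable {p : ℕ} [Fact p.Prime] {K L : Type} [Field K] [Field L] [Algebra ℚ_[p] K]
  [Algebra ℚ_[p] L] [Algebra K L] [IsScalarTower ℚ_[p] K L]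

theorem intMap_dvd_intMap_iff {x y : O p K} : intMap p K L x ∣ intMap p K L y ↔ x ∣ y := by
  refine ⟨?_, map_dvd _⟩
  rintro ⟨z, hz⟩
  have hz' : algebraMap K L y = algebraMap K L x * z := congrArg Subtype.val hz
  rcases eq_or_ne x 0 with rfl | hx
  · have hy : (y : K) = 0 := by simpa using hz'
    exact ⟨0, Subtype.ext (by simpa using hy)⟩
  have hx' : (x : K) ≠ 0 := fun h => hx (Subtype.ext h)
  have hzq : algebraMap K L (y / x) = z := by
    rw [map_div₀, hz', mul_div_cancel_left₀ _ ((map_ne_zero _).2 hx')]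
  have hint : IsIntegral ℤ_[p] ((y : K) / x) := by
    rw [← isIntegral_algHom_iff (IsScalarTower.toAlgHom ℤ_[p] K L) (algebraMap K L).injective,
      IsScalarTower.coe_toAlgHom', hzq]
    exact z.2
  exact ⟨⟨_, hint⟩, Subtype.ext (mul_div_cancel₀ _ hx').symm⟩

variable [FiniteDimensional ℚ_[p] K] [FiniteDimensional ℚ_[p] L]

theorem irreducible_intMap (hKL : IsUnramifiedExt p K L) {π : O p K} (hπ : Irreducible π) :
    Irreducible (intMap p K L π) := by
  rw [IsDiscreteValuationRing.irreducible_iff_uniformizer, ← maxIdeal_eq_maximalIdeal, ← hKL,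
    maxIdeal_eq_maximalIdeal, hπ.maximalIdeal_eq, Ideal.map_span, Set.image_singleton]

theorem exists_pow_dvd_mul_pow_sub_one (hKL : IsUnramifiedExt p K L) {π a : O p K} {b : O p L}
    {m : ℕ} (hπ : Irreducible π) (hpπ : π ^ (m * (p - 1)) ∣ (p : O p K)) (ha : IsUnit a)
    (hab : b ^ p = intMap p K L a) {n : ℕ} (hn : n ≤ p * m) :
    ∃ w : O p K, IsUnit w ∧ π ^ n ∣ a * w ^ p - 1 := by
  have hp : p.Prime := Fact.out
  induction n with
  | zero => exact ⟨1, isUnit_one, by simp⟩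
  | succ n ih =>
    obtain ⟨w, hw, hdvd⟩ := ih (Nat.le_of_succ_le hn)
    have hmap : (1 + (b * intMap p K L w - 1)) ^ p - 1 = intMap p K L (a * w ^ p - 1) := by
      rw [add_sub_cancel, mul_pow, hab, map_sub, map_mul, map_pow, map_one]
    have hpL : intMap p K L π ^ (m * (p - 1)) ∣ (p : O p L) := by
      rw [← map_natCast (intMap p K L), ← map_pow]
      exact map_dvd _ hpπ
    have hstep := pow_succ_dvd_or_eq_mul_of_pow_dvd_one_add_pow_sub_one hp
      (irreducible_intMap hKL hπ) hpL hn (b := b * intMap p K L w - 1)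
    rw [hmap, ← map_pow, ← map_pow, intMap_dvd_intMap_iff, intMap_dvd_intMap_iff] at hstep
    rcases hstep hdvd with h | ⟨i, hi, rfl⟩
    · exact ⟨w, hw, h⟩
    · have hπmem : π ∈ IsLocalRing.maximalIdeal (O p K) := hπ.not_isUnit
      have hpow : ∀ a : O p K, ∃ b, π ∣ a - b ^ p := by
        intro a
        obtain ⟨b, hb⟩ := exists_sub_pow_mem_maximalIdeal p K a
        rw [hπ.maximalIdeal_eq, Ideal.mem_span_singleton] at hb
        exact ⟨b, hb⟩
      obtain ⟨w', hw', hdvd'⟩ := exists_isUnit_pow_succ_dvd_mul_pow_sub_one hp hπmem hpow hpπ hi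
        (ha.mul (hw.pow p)) hdvd
      exact ⟨w * w', hw.mul hw', by rwa [mul_pow, ← mul_assoc]⟩

theorem isUnramifiedExt_of_isUnit_aeval_derivative {f : Polynomial (O p K)} (hf : f.Monic) {z : L}
    (hz : Algebra.adjoin K {z} = ⊤) (hfz : f.eval₂ (algebraMap (O p K) L) z = 0)
    (hf' : ∀ z' : O p L, (z' : L) = z →
      IsUnit ((Polynomial.derivative f).eval₂ (intMap p K L) z')) :
    IsUnramifiedExt p K L := by
  let _ : Algebra (O p K) (O p L) := (intMap p K L).toAlgebra
  have : IsScalarTower ℤ_[p] (O p K) L := IsScalarTower.of_algebraMap_eq fun x => by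
    rw [IsScalarTower.algebraMap_apply ℤ_[p] K L]; rfl
  have : IsScalarTower (O p K) (O p L) L := IsScalarTower.of_algebraMap_eq fun x => rfl
  have : IsScalarTower ℤ_[p] (O p K) (O p L) := IsScalarTower.of_algebraMap_eq fun x =>
    Subtype.ext (IsScalarTower.algebraMap_apply ℤ_[p] K L x)
  have : FiniteDimensional K L := FiniteDimensional.right ℚ_[p] K L
  have : CharZero K := charZero_of_injective_algebraMap (algebraMap ℚ_[p] K).injective
  have : Module.Finite (O p K) (O p L) := Module.Finite.of_restrictScalars_finite ℤ_[p] _ _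
  have : IsIntegralClosure (O p L) (O p K) L := IsIntegralClosure.tower_top (R := ℤ_[p])
  have hzint : IsIntegral ℤ_[p] z := isIntegral_trans (A := O p K) z ⟨f, hf, hfz⟩
  obtain ⟨z, rfl⟩ : ∃ z' : O p L, (z' : L) = z := ⟨⟨z, hzint⟩, rfl⟩
  have hroot : Polynomial.aeval z f = 0 := by
    refine IsIntegralClosure.algebraMap_injective (O p L) (O p K) L ?_
    rw [← Polynomial.aeval_algebraMap_apply, map_zero]
    exact hfz
  have hunit : IsUnit (Polynomial.aeval z (Polynomial.derivative f)) := hf' z rfl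
  have : Algebra.FormallyUnramified (O p K) (O p L) :=
    formallyUnramified_of_adjoin_eq_top
      (adjoin_eq_top_of_isUnit_aeval_derivative (O p K) K L hz hroot hunit) hroot hunit
  rw [IsUnramifiedExt, maxIdeal_eq_maximalIdeal, maxIdeal_eq_maximalIdeal]
  have : IsLocalHom (algebraMap (O p K) (O p L)) := ⟨fun a ha => by
    rw [isUnit_iff_dvd_one] at ha ⊢
    rwa [← intMap_dvd_intMap_iff (L := L), map_one]⟩
  exact Algebra.FormallyUnramified.map_maximalIdeal (R := O p K) (S := O p L)

end Extension

section UnitGroup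

theorem UnramifiedRootWitness.nonempty_mul_pow {p : ℕ} [Fact p.Prime] {K : Type} [Field K]
    [Algebra ℚ_[p] K] {n : ℕ} {a : K} (h : Nonempty (UnramifiedRootWitness p K n a)) (w : K) :
    Nonempty (UnramifiedRootWitness p K n (a * w ^ n)) := by
  obtain ⟨⟨L, β, hβ, hL⟩⟩ := h
  exact ⟨⟨L, β * algebraMap K L w, by rw [mul_pow, hβ, map_mul, map_pow], hL⟩⟩

open Polynomial IntermediateField

variable {p : ℕ} [Fact p.Prime] {K : Type} [Field K] [Algebra ℚ_[p] K] [FiniteDimensional ℚ_[p] K]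

theorem nonempty_unramifiedRootWitness {π u d v : O p K} {m : ℕ} (hπ : Irreducible π)
    (hm : 0 < m) (hv : IsUnit v) (hpπ : (p : O p K) = v * (π ^ m) ^ (p - 1))
    (hu : u = 1 + (π ^ m) ^ p * d) : Nonempty (UnramifiedRootWitness p K p (u : K)) := by
  have hp : p.Prime := Fact.out
  obtain ⟨g, hgdeg, hg⟩ := exists_one_add_C_mul_X_pow_eq hp (π := π) (s := π ^ (m - 1))
    (by rw [← pow_succ', Nat.sub_add_cancel hm]) hpπ
  obtain ⟨β, hβ⟩ := IsAlgClosed.exists_pow_nat_eq (algebraMap K (AlgebraicClosure K) u) hp.pos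
  have hl0 : (π ^ m : O p K) ≠ 0 := pow_ne_zero _ hπ.ne_zero
  set l : K := ((π ^ m : O p K) : K) with hl
  have hlK : l ≠ 0 := fun h => hl0 (Subtype.ext h)
  have hlC : algebraMap K (AlgebraicClosure K) l ≠ 0 := (_root_.map_ne_zero _).2 hlK
  set ζ : AlgebraicClosure K := (β - 1) / algebraMap K _ l with hζ
  have hβζ : 1 + algebraMap K _ l * ζ = β := by
    rw [hζ, mul_div_cancel₀ _ hlC, add_sub_cancel]
  have hζint : IsIntegral K ζ := Algebra.IsIntegral.isIntegral ζ
  have : FiniteDimensional K K⟮ζ⟯ := adjoin.finiteDimensional hζint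
  have : FiniteDimensional ℚ_[p] K⟮ζ⟯ := FiniteDimensional.trans ℚ_[p] K K⟮ζ⟯
  set z : K⟮ζ⟯ := AdjoinSimple.gen K ζ with hz
  have hpow : (1 + algebraMap K K⟮ζ⟯ l * z) ^ p = algebraMap K K⟮ζ⟯ u := by
    apply (algebraMap K⟮ζ⟯ (AlgebraicClosure K)).injective
    rw [map_pow, map_add, map_one, map_mul, hz, AdjoinSimple.algebraMap_gen,
      ← IsScalarTower.algebraMap_apply, ← IsScalarTower.algebraMap_apply, hβζ, hβ]
  have hdeg : (C v * (X + C π * g) - C d).degree < (p : WithBot ℕ) := by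
    refine (degree_sub_le _ _).trans_lt (max_lt ?_ ?_)
    · rw [C_mul']
      refine (degree_smul_le _ _).trans_lt ((degree_add_le _ _).trans_lt (max_lt ?_ ?_))
      · exact degree_X_le.trans_lt (by exact_mod_cast hp.one_lt)
      · rw [C_mul']
        exact (degree_smul_le _ _).trans_lt hgdeg
    · exact degree_C_le.trans_lt (by exact_mod_cast hp.pos)
  set f : (O p K)[X] := X ^ p + (C v * (X + C π * g) - C d) with hf
  have hmonic : f.Monic := monic_X_pow_add hdeg
  have hfz : f.eval₂ (algebraMap (O p K) K⟮ζ⟯) z = 0 := by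
    have hfl : (1 + C (π ^ m) * X) ^ p = C u + C ((π ^ m) ^ p) * f := by
      rw [hg, hf, hu]; simp only [C_add, C_mul, C_1]; ring
    have h := congrArg (eval₂ (algebraMap (O p K) K⟮ζ⟯) z) hfl
    rw [eval₂_pow, eval₂_add, eval₂_one, eval₂_mul, eval₂_C, eval₂_X, eval₂_add, eval₂_mul,
      eval₂_C, eval₂_C] at h
    have h' : algebraMap K K⟮ζ⟯ u = algebraMap K K⟮ζ⟯ u
        + algebraMap (O p K) K⟮ζ⟯ ((π ^ m) ^ p) * eval₂ (algebraMap (O p K) K⟮ζ⟯) z f :=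
      hpow.symm.trans h
    have h0 : algebraMap (O p K) K⟮ζ⟯ ((π ^ m) ^ p) ≠ 0 := by
      rw [map_pow]
      exact pow_ne_zero _ ((_root_.map_ne_zero (algebraMap K K⟮ζ⟯)).2 hlK)
    exact (mul_eq_zero.1 (left_eq_add.1 h')).resolve_left h0
  refine ⟨⟨K⟮ζ⟯, 1 + algebraMap K K⟮ζ⟯ l * z, hpow,
    isUnramifiedExt_of_isUnit_aeval_derivative hmonic (z := z) ?_ hfz ?_⟩⟩
  · have := (adjoin.powerBasis hζint).adjoin_gen_eq_top
    rwa [adjoin.powerBasis_gen] at this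
  · intro z' _
    have hπL : intMap p K K⟮ζ⟯ π ∈ IsLocalRing.maximalIdeal (O p K⟮ζ⟯) := by
      refine fun hunit => hπ.not_isUnit (isUnit_iff_dvd_one.2 ?_)
      rw [← intMap_dvd_intMap_iff (L := K⟮ζ⟯), map_one]
      exact isUnit_iff_dvd_one.1 hunit
    have hpL : (p : O p K⟮ζ⟯) ∈ IsLocalRing.maximalIdeal (O p K⟮ζ⟯) :=
      natCast_mem_maximalIdeal p _
    have hder : (derivative f).eval₂ (intMap p K K⟮ζ⟯) z' = intMap p K K⟮ζ⟯ v
        + (p * z' ^ (p - 1) + intMap p K K⟮ζ⟯ π *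
          (intMap p K K⟮ζ⟯ v * (derivative g).eval₂ (intMap p K K⟮ζ⟯) z')) := by
      simp only [hf, derivative_add, derivative_sub, derivative_X_pow, derivative_C_mul,
        derivative_X, derivative_C, eval₂_add, eval₂_sub, eval₂_mul, eval₂_C, eval₂_one,
        eval₂_pow, eval₂_X, eval₂_zero, map_natCast, eval₂_natCast]
      ring
    by_contra hcon
    have hmem := (IsLocalRing.mem_maximalIdeal _).2 hcon
    rw [hder, Ideal.add_mem_iff_left _
      (add_mem (Ideal.mul_mem_right _ _ hpL) (Ideal.mul_mem_right _ _ hπL))] at hmem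
    exact (IsLocalRing.mem_maximalIdeal _).1 hmem (hv.map _)

end UnitGroup

end PadicStmt

/-- Let `K` be a finite extension of `ℚ_p` containing a primitive `p`-th
root of unity.  A unit `α` of `O_K` is `p`-primary iff `α = u·w^p` with
`u ∈ U_{p ē_K, K}` and `w ∈ O_K^×`, where `ē_K = e_K/(p-1)`. -/
theorem stmt9 (p : ℕ) [Fact p.Prime] (K : Type) [Field K] [Algebra ℚ_[p] K]
    [FiniteDimensional ℚ_[p] K]
    (ζ : K) (hζ : IsPrimitiveRoot ζ p)
    (ebar : ℕ) (hebar : ebar * (p - 1) = eK p K)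
    (α : K) (hα : IsIntegralUnit p K α) :
    IsPPrimary p K α ↔
      ∃ u w : K, InU p K (p * ebar) u ∧ IsIntegralUnit p K w ∧ α = u * w ^ p := by
  have hp : p.Prime := Fact.out
  obtain ⟨π, hπ⟩ := IsDiscreteValuationRing.exists_irreducible (O p K)
  obtain ⟨v, hv⟩ := (associated_natCast_pow_eK hπ).symm
  rw [← hebar] at hv
  obtain ⟨a, rfl⟩ := hα
  constructor
  · rintro ⟨-, ⟨L, β, hβ, hL⟩⟩
    have hβint : IsIntegral ℤ_[p] β := by
      refine IsIntegral.of_pow hp.pos ?_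
      rw [hβ]
      exact (intMap p K L a).2
    obtain ⟨w, ⟨w, rfl⟩, hdvd⟩ := exists_pow_dvd_mul_pow_sub_one hL (b := ⟨β, hβint⟩) hπ
      ⟨v, hv.symm⟩ a.isUnit (Subtype.ext hβ) le_rfl
    refine ⟨((a * w ^ p : (O p K)ˣ) : O p K), ((w⁻¹ : (O p K)ˣ) : O p K),
      (inU_coe_iff hπ _).2 (by simpa using hdvd), ⟨_, rfl⟩, ?_⟩
    have : (a : O p K) = (a * w ^ p : (O p K)ˣ) * ((w⁻¹ : (O p K)ˣ) : O p K) ^ p := by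
      rw [← Units.val_pow_eq_pow_val, ← Units.val_mul, mul_assoc, ← mul_pow, mul_inv_cancel,
        one_pow, mul_one]
    exact congrArg Subtype.val this
  · rintro ⟨u, w, hu, -, huw⟩
    refine ⟨⟨a, rfl⟩, ?_⟩
    rw [huw]
    obtain ⟨u, rfl⟩ := hu.1
    obtain ⟨d, hd⟩ := (inU_coe_iff hπ u).1 hu
    have hebar0 : 0 < ebar := by
      rw [Nat.pos_iff_ne_zero]
      rintro rfl
      refine (IsLocalRing.mem_maximalIdeal _).1 (natCast_mem_maximalIdeal p K) ?_
      rw [← hv]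
      simp
    refine UnramifiedRootWitness.nonempty_mul_pow ?_ w
    refine nonempty_unramifiedRootWitness (d := d) hπ hebar0 v.isUnit ?_ ?_
    · rw [← hv, ← pow_mul, mul_comm]
    · rw [← pow_mul, mul_comm ebar, ← hd]; ring
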